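/- (Symbol estimates of order −1.) Let ũ ∈ 𝓢(ℝ,ℂ) and define h(ξ) := ∫_{x ∈ (0,∞)} exp(−i·x·ξ) · ũ(x) dx for ξ ∈ ℝ. Then h is smooth on ℝ, its k-th derivative satisfies ∂_ξ^k h(ξ) = (−i)^k ∫_{x ∈ (0,∞)} exp(−i·x·ξ) · x^k · ũ(x) dx, and for every k ∈ ℕ there exists C_k > 0 such that |∂_ξ^k h(ξ)| ≤ C_k (1+|ξ|)^{−1−k} for all ξ ∈ ℝ. -/

import Mathlib

open MeasureTheory Complex

open scoped SchwartzMap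

/-- The Fourier transform of the restriction of a Schwartz function to `(0, ∞)`. -/
noncomputable def halfLineFourier (v : 𝓢(ℝ, ℂ)) (ξ : ℝ) : ℂ :=
  ∫ x in Set.Ioi (0 : ℝ), Complex.exp (-(Complex.I * x * ξ)) * v x

/-- Multiplication of a Schwartz function by `x ^ k`. -/
noncomputable def schwartzMulPow (k : ℕ) (v : 𝓢(ℝ, ℂ)) : 𝓢(ℝ, ℂ) :=
  SchwartzMap.smulLeftCLM ℂ (fun x : ℝ => x ^ k) v

theorem schwartzMulPow_apply (k : ℕ) (v : 𝓢(ℝ, ℂ)) (x : ℝ) :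
    schwartzMulPow k v x = (x : ℂ) ^ k * v x := by
  rw [schwartzMulPow, SchwartzMap.smulLeftCLM_apply_apply (by fun_prop)]
  simp

theorem schwartzMulPow_zero (v : 𝓢(ℝ, ℂ)) : schwartzMulPow 0 v = v := by
  ext x
  simp [schwartzMulPow_apply]

theorem schwartzMulPow_one_mulPow (k : ℕ) (v : 𝓢(ℝ, ℂ)) :
    schwartzMulPow 1 (schwartzMulPow k v) = schwartzMulPow (k + 1) v := by
  ext x
  simp only [schwartzMulPow_apply]
  ring

theorem derivCLM_schwartzMulPow_succ (k : ℕ) (v : 𝓢(ℝ, ℂ)) :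
    SchwartzMap.derivCLM ℝ ℂ (schwartzMulPow (k + 1) v) =
      schwartzMulPow k ((k + 1 : ℝ) • v + schwartzMulPow 1 (SchwartzMap.derivCLM ℝ ℂ v)) := by
  ext x
  have h : HasDerivAt (fun y : ℝ => (y : ℂ) ^ (k + 1) * v y)
      (((k + 1 : ℕ) * (x : ℂ) ^ k) * v x + (x : ℂ) ^ (k + 1) * deriv v x) x := by
    have hp : HasDerivAt (fun y : ℝ => (y : ℂ) ^ (k + 1)) ((k + 1 : ℕ) * (x : ℂ) ^ k) x := by
      simpa using (hasDerivAt_pow (k + 1) (x : ℂ)).comp_ofReal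
    exact hp.mul v.differentiableAt.hasDerivAt
  rw [SchwartzMap.derivCLM_apply, funext (schwartzMulPow_apply (k + 1) v), h.deriv]
  simp only [schwartzMulPow_apply, add_apply, smul_apply,
    SchwartzMap.derivCLM_apply, real_smul]
  push_cast
  ring

theorem norm_exp_neg_I_mul_mul (x ξ : ℝ) : ‖Complex.exp (-(Complex.I * x * ξ))‖ = 1 := by
  rw [Complex.norm_exp]
  simp

theorem integrable_exp_mul_schwartz (v : 𝓢(ℝ, ℂ)) (ξ : ℝ) (s : Set ℝ) :
    IntegrableOn (fun x : ℝ => Complex.exp (-(Complex.I * x * ξ)) * v x) s := by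
  refine Integrable.mono (v.integrable (μ := volume)).integrableOn
    (Continuous.aestronglyMeasurable (by have := v.continuous; fun_prop)) (.of_forall fun x => ?_)
  rw [norm_mul, norm_exp_neg_I_mul_mul, one_mul]

theorem norm_halfLineFourier_le (v : 𝓢(ℝ, ℂ)) (ξ : ℝ) :
    ‖halfLineFourier v ξ‖ ≤ ∫ x in Set.Ioi (0 : ℝ), ‖v x‖ := by
  refine (norm_integral_le_integral_norm _).trans_eq ?_
  simp only [norm_mul, norm_exp_neg_I_mul_mul, one_mul]

theorem hasDerivAt_halfLineFourier (v : 𝓢(ℝ, ℂ)) (ξ : ℝ) :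
    HasDerivAt (halfLineFourier v) (-Complex.I * halfLineFourier (schwartzMulPow 1 v) ξ) ξ := by
  have h := (hasDerivAt_integral_of_dominated_loc_of_deriv_le
    (μ := volume.restrict (Set.Ioi (0 : ℝ)))
    (F := fun (ξ x : ℝ) => Complex.exp (-(Complex.I * x * ξ)) * v x)
    (F' := fun (ξ x : ℝ) =>
      -Complex.I * (Complex.exp (-(Complex.I * x * ξ)) * schwartzMulPow 1 v x))
    (x₀ := ξ) (s := Set.univ) (bound := fun x => ‖schwartzMulPow 1 v x‖) Filter.univ_mem
    (.of_forall fun η => (integrable_exp_mul_schwartz v η _).aestronglyMeasurable)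
    (integrable_exp_mul_schwartz v ξ _)
    ((integrable_exp_mul_schwartz (schwartzMulPow 1 v) ξ _).const_mul _).aestronglyMeasurable
    (.of_forall fun x η _ => ?_)
    (schwartzMulPow 1 v).integrable.norm.integrableOn
    (.of_forall fun x η _ => ?_)).2
  · rw [integral_const_mul] at h
    exact h
  · simp only [norm_mul, norm_neg, norm_I, norm_exp_neg_I_mul_mul, one_mul, le_refl]
  · have hl : HasDerivAt (fun y : ℝ => -(Complex.I * x * (y : ℂ))) (-(Complex.I * x)) η := by
      simpa using ((hasDerivAt_id (η : ℂ)).const_mul (Complex.I * x)).neg.comp_ofReal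
    refine (hl.cexp.mul_const (v x)).congr_deriv ?_
    rw [schwartzMulPow_apply]
    ring

theorem iteratedDeriv_halfLineFourier (k : ℕ) (v : 𝓢(ℝ, ℂ)) :
    iteratedDeriv k (halfLineFourier v) =
      fun ξ => (-Complex.I) ^ k * halfLineFourier (schwartzMulPow k v) ξ := by
  induction k with
  | zero => simp [schwartzMulPow_zero]
  | succ k ih =>
    ext ξ
    rw [iteratedDeriv_succ, ih, ((hasDerivAt_halfLineFourier _ ξ).const_mul _).deriv,
      schwartzMulPow_one_mulPow]
    ring

theorem contDiff_halfLineFourier (v : 𝓢(ℝ, ℂ)) :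
    ContDiff ℝ (⊤ : ℕ∞) (halfLineFourier v) := by
  refine contDiff_of_differentiable_iteratedDeriv fun k _ => ?_
  rw [iteratedDeriv_halfLineFourier]
  exact fun ξ => ((hasDerivAt_halfLineFourier _ ξ).const_mul _).differentiableAt

theorem I_mul_halfLineFourier (v : 𝓢(ℝ, ℂ)) (ξ : ℝ) :
    Complex.I * ξ * halfLineFourier v ξ =
      v 0 + halfLineFourier (SchwartzMap.derivCLM ℝ ℂ v) ξ := by
  have hd : ∀ x ∈ Set.Ici (0 : ℝ),
      HasDerivAt (fun y : ℝ => Complex.exp (-(Complex.I * y * ξ)) * v y)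
        (Complex.exp (-(Complex.I * x * ξ)) * SchwartzMap.derivCLM ℝ ℂ v x -
          Complex.I * ξ * (Complex.exp (-(Complex.I * x * ξ)) * v x)) x := by
    intro x _
    have hl : HasDerivAt (fun y : ℝ => -(Complex.I * (y : ℂ) * ξ)) (-(Complex.I * ξ)) x := by
      simpa using
        (((hasDerivAt_id (x : ℂ)).const_mul Complex.I).mul_const (ξ : ℂ)).neg.comp_ofReal
    refine (hl.cexp.mul v.differentiableAt.hasDerivAt).congr_deriv ?_
    rw [SchwartzMap.derivCLM_apply]
    ring
  have hv := integrable_exp_mul_schwartz v ξ (Set.Ioi 0)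
  have hv' := integrable_exp_mul_schwartz (SchwartzMap.derivCLM ℝ ℂ v) ξ (Set.Ioi 0)
  have ht : Filter.Tendsto (fun y : ℝ => Complex.exp (-(Complex.I * y * ξ)) * v y)
      Filter.atTop (nhds 0) := by
    rw [tendsto_zero_iff_norm_tendsto_zero]
    simp only [norm_mul, norm_exp_neg_I_mul_mul, one_mul]
    exact tendsto_zero_iff_norm_tendsto_zero.mp (v.tendsto_cocompact.mono_left atTop_le_cocompact)
  have h := integral_Ioi_of_hasDerivAt_of_tendsto' hd (hv'.sub (hv.const_mul _)) ht
  rw [integral_sub hv' (hv.const_mul _), integral_const_mul] at h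
  change halfLineFourier _ ξ - Complex.I * ξ * halfLineFourier v ξ = _ at h
  simp only [ofReal_zero, mul_zero, zero_mul, neg_zero, Complex.exp_zero, one_mul, zero_sub] at h
  linear_combination -h

theorem abs_pow_mul_norm_halfLineFourier_le (k : ℕ) (v : 𝓢(ℝ, ℂ)) :
    ∃ C : ℝ, ∀ ξ : ℝ, |ξ| ^ (k + 1) * ‖halfLineFourier (schwartzMulPow k v) ξ‖ ≤ C := by
  have key (w : 𝓢(ℝ, ℂ)) (ξ : ℝ) : |ξ| * ‖halfLineFourier w ξ‖ =
      ‖w 0 + halfLineFourier (SchwartzMap.derivCLM ℝ ℂ w) ξ‖ := by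
    simp [← I_mul_halfLineFourier]
  induction k generalizing v with
  | zero =>
    refine ⟨‖v 0‖ + ∫ x in Set.Ioi (0 : ℝ), ‖SchwartzMap.derivCLM ℝ ℂ v x‖, fun ξ => ?_⟩
    rw [schwartzMulPow_zero, zero_add, pow_one, key]
    grw [norm_add_le, norm_halfLineFourier_le]
  | succ k ih =>
    obtain ⟨C, hC⟩ := ih ((k + 1 : ℝ) • v + schwartzMulPow 1 (SchwartzMap.derivCLM ℝ ℂ v))
    refine ⟨C, fun ξ => ?_⟩
    rw [pow_succ, mul_assoc, key, derivCLM_schwartzMulPow_succ, schwartzMulPow_apply]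
    simpa using hC ξ

theorem norm_iteratedDeriv_halfLineFourier_le (k : ℕ) (v : 𝓢(ℝ, ℂ)) :
    ∃ C : ℝ, 0 < C ∧ ∀ ξ : ℝ,
      ‖iteratedDeriv k (halfLineFourier v) ξ‖ ≤ C * (1 + |ξ|) ^ (-1 - (k : ℝ)) := by
  obtain ⟨C, hC⟩ := abs_pow_mul_norm_halfLineFourier_le k v
  set B : ℝ := ∫ x in Set.Ioi (0 : ℝ), ‖schwartzMulPow k v x‖
  refine ⟨2 ^ k * (|B| + |C|) + 1, by positivity, fun ξ => ?_⟩
  have hpos : 0 < 1 + |ξ| := by positivity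
  have hexp : (1 + |ξ|) ^ (-1 - (k : ℝ)) = ((1 + |ξ|) ^ (k + 1))⁻¹ := by
    rw [← Real.rpow_natCast, ← Real.rpow_neg hpos.le]
    congr 1
    push_cast
    ring
  rw [hexp, ← div_eq_mul_inv, le_div_iff₀ (by positivity), iteratedDeriv_halfLineFourier,
    norm_mul, norm_pow, norm_neg, norm_I, one_pow, one_mul]
  have hB := norm_halfLineFourier_le (schwartzMulPow k v) ξ
  calc ‖halfLineFourier (schwartzMulPow k v) ξ‖ * (1 + |ξ|) ^ (k + 1)
      ≤ ‖halfLineFourier (schwartzMulPow k v) ξ‖ * (2 ^ k * (1 ^ (k + 1) + |ξ| ^ (k + 1))) := by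
        gcongr
        exact add_pow_le zero_le_one (abs_nonneg ξ) (k + 1)
    _ = 2 ^ k * (‖halfLineFourier (schwartzMulPow k v) ξ‖ +
          |ξ| ^ (k + 1) * ‖halfLineFourier (schwartzMulPow k v) ξ‖) := by
        rw [one_pow]
        ring
    _ ≤ 2 ^ k * (|B| + |C|) := by
        gcongr
        · exact hB.trans (le_abs_self B)
        · exact (hC ξ).trans (le_abs_self C)
    _ ≤ 2 ^ k * (|B| + |C|) + 1 := by linarith

/-- Symbol estimates of order `-1` for the half-line Fourier transform of a Schwartz
function: it is smooth, its derivatives are given by differentiating under the integral,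
and `|∂_ξ^k h(ξ)| ≤ C_k (1+|ξ|)^{-1-k}`. -/
theorem halfline_fourier_symbol_estimates (u : SchwartzMap ℝ ℂ) :
    ContDiff ℝ (⊤ : ℕ∞) (fun ξ : ℝ =>
      ∫ x in Set.Ioi (0 : ℝ), Complex.exp (-(Complex.I * x * ξ)) * u x) ∧
    (∀ k : ℕ, ∀ ξ : ℝ,
      iteratedDeriv k (fun ξ : ℝ =>
        ∫ x in Set.Ioi (0 : ℝ), Complex.exp (-(Complex.I * x * ξ)) * u x) ξ
      = (-Complex.I) ^ k *
        ∫ x in Set.Ioi (0 : ℝ), Complex.exp (-(Complex.I * x * ξ)) * (x : ℂ) ^ k * u x) ∧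
    ∀ k : ℕ, ∃ C : ℝ, 0 < C ∧ ∀ ξ : ℝ,
      ‖iteratedDeriv k (fun ξ : ℝ =>
          ∫ x in Set.Ioi (0 : ℝ), Complex.exp (-(Complex.I * x * ξ)) * u x) ξ‖
        ≤ C * (1 + |ξ|) ^ (-1 - (k : ℝ)) := by
  refine ⟨contDiff_halfLineFourier u, fun k ξ => ?_,
    fun k => norm_iteratedDeriv_halfLineFourier_le k u⟩
  refine (congrFun (iteratedDeriv_halfLineFourier k u) ξ).trans ?_
  simp only [halfLineFourier, schwartzMulPow_apply, mul_assoc]
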